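/- arXiv:1004.3854 — 2 statements merged into one kernel-verified Lean document; each statement's English description precedes it below -/
import Mathlib

section
/- Let n be a positive integer and a a real parameter. Consider the Hamiltonian H = (1/2)(p_r² + p_φ²/r²) + a/(r² cos²(nφ)) and set G := (1/2)p_φ² + a/cos²(nφ). Then on the open set where r > 0, cos(nφ) ≠ 0, sin(nφ) ≠ 0 and G > 0, the functions F₁ := Σ_{k=0}^{⌊n/2⌋} (−1)ᵏ C(n,2k) (2G)^{(n−2k)/2} (p_r^{2k}/r^{n−2k}) [ p_φ cos(nφ) + ((n−2k)/(2k+1)) r p_r sin(nφ) ] and F₂ := Σ_{k=0}^{⌊n/2⌋} (−1)ᵏ C(n,2k) (2G)^{(n−2k−1)/2} (p_r^{2k}/r^{n−2k}) [ 2G sin(nφ) − ((n−2k)/(2k+1)) r p_r p_φ cos(nφ) ] are first integrals of H: {H,F₁} = 0 and {H,F₂} = 0. -/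
/-- The canonical Poisson bracket of two functions of `(r, φ, p_r, p_φ)`. -/
noncomputable def poissonBracket (F G : ℝ → ℝ → ℝ → ℝ → ℝ)
    (r φ pr pφ : ℝ) : ℝ :=
  deriv (fun x => F x φ pr pφ) r * deriv (fun x => G r φ x pφ) pr
  - deriv (fun x => F r φ x pφ) pr * deriv (fun x => G x φ pr pφ) r
  + deriv (fun x => F r x pr pφ) φ * deriv (fun x => G r φ pr x) pφ
  - deriv (fun x => F r φ pr x) pφ * deriv (fun x => G r x pr pφ) φ

open Complex in
/-- Binomial expansion of `(u + i v) ^ n`, grouped by pairs of consecutive powers of `v`. -/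
lemma add_I_mul_pow_eq_sum (n : ℕ) (u v : ℝ) :
    ((u : ℂ) + I * v) ^ n = ∑ k ∈ Finset.range (n / 2 + 1),
      (-1 : ℂ) ^ k * ((n.choose (2 * k) : ℂ) * u ^ (n - 2 * k) * v ^ (2 * k)
        + I * ((n.choose (2 * k + 1) : ℂ) * u ^ (n - 2 * k - 1) * v ^ (2 * k + 1))) := by
  have pair_sum : ∀ (f : ℕ → ℂ) (N : ℕ), ∑ i ∈ Finset.range (2 * N), f i
      = ∑ k ∈ Finset.range N, (f (2 * k) + f (2 * k + 1)) := by
    intro f N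
    induction N with
    | zero => simp
    | succ N ih =>
      rw [Finset.sum_range_succ, ← ih, show 2 * (N + 1) = 2 * N + 1 + 1 by ring,
        Finset.sum_range_succ, Finset.sum_range_succ, add_assoc]
  have extend : ∑ i ∈ Finset.range (n + 1),
        (I * (v : ℂ)) ^ i * (u : ℂ) ^ (n - i) * (n.choose i : ℂ)
      = ∑ i ∈ Finset.range (2 * (n / 2 + 1)),
        (I * (v : ℂ)) ^ i * (u : ℂ) ^ (n - i) * (n.choose i : ℂ) := by
    apply Finset.sum_subset
    · intro i hi
      simp only [Finset.mem_range] at *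
      omega
    · intro i _ hi
      simp only [Finset.mem_range] at hi
      rw [Nat.choose_eq_zero_of_lt (by omega)]
      simp
  rw [add_comm, add_pow, extend, pair_sum]
  refine Finset.sum_congr rfl fun k _ => ?_
  rw [mul_pow, mul_pow, pow_succ I, pow_mul I, I_sq, ← Nat.sub_sub]
  ring

lemma rpow_half_eq_sqrt_pow {x : ℝ} (hx : 0 ≤ x) {n k : ℕ} (hk : 2 * k ≤ n) :
    Real.rpow x (((n : ℝ) - 2 * k) / 2) = √x ^ (n - 2 * k) := by
  rw [Real.sqrt_eq_rpow, ← Real.rpow_natCast, ← Real.rpow_mul hx]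
  push_cast [Nat.cast_sub hk]
  rw [Real.rpow_eq_pow]
  congr 1
  ring

lemma rpow_half_mul_sqrt_eq_sqrt_pow {x : ℝ} (hx : 0 < x) {n k : ℕ} (hk : 2 * k ≤ n) :
    Real.rpow x (((n : ℝ) - 2 * k - 1) / 2) * √x = √x ^ (n - 2 * k) := by
  rw [← rpow_half_eq_sqrt_pow hx.le hk, Real.sqrt_eq_rpow, Real.rpow_eq_pow, Real.rpow_eq_pow,
    ← Real.rpow_add hx]
  congr 1
  ring

lemma choose_mul_div_eq_choose_succ {n k : ℕ} (hk : 2 * k ≤ n) :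
    (n.choose (2 * k) : ℝ) * (((n : ℝ) - 2 * k) / (2 * k + 1)) = n.choose (2 * k + 1) := by
  have h := congrArg (Nat.cast (R := ℝ)) (Nat.choose_succ_right_eq n (2 * k))
  push_cast [Nat.cast_sub hk] at h
  rw [mul_div_assoc', ← h]
  field_simp

/-- The complex first integral `(s / r + i p_r) ^ n (p_φ cos θ - i s sin θ)`, with `c = cos θ` and
`σ = sin θ`. -/
noncomputable def complexIntegral (n : ℕ) (s r pr pφ c σ : ℝ) : ℂ :=
  (((s / r : ℝ) : ℂ) + Complex.I * pr) ^ n * ((pφ * c : ℝ) - Complex.I * (s * σ : ℝ))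

lemma choose_succ_mul_pow_div {n k : ℕ} (hk : 2 * k ≤ n) (s : ℝ) {r : ℝ} (hr : r ≠ 0) :
    (n.choose (2 * k + 1) : ℝ) * ((s / r) ^ (n - 2 * k - 1) * s)
      = (n.choose (2 * k + 1) : ℝ) * (s ^ (n - 2 * k) / r ^ (n - 2 * k) * r) := by
  rcases hk.eq_or_lt with h | h
  · rw [Nat.choose_eq_zero_of_lt (by omega)]
    simp
  · obtain ⟨j, hj⟩ : ∃ j, n - 2 * k = j + 1 := ⟨n - 2 * k - 1, by omega⟩
    rw [hj, Nat.add_sub_cancel, div_pow, pow_succ, pow_succ]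
    field_simp

lemma complexIntegral_eq_sum (n : ℕ) (s r pr pφ c σ : ℝ) :
    complexIntegral n s r pr pφ c σ = ∑ k ∈ Finset.range (n / 2 + 1),
      (((-1) ^ k * ((n.choose (2 * k) : ℝ) * (s / r) ^ (n - 2 * k) * pr ^ (2 * k) * (pφ * c)
          + (n.choose (2 * k + 1) : ℝ) * (s / r) ^ (n - 2 * k - 1) * pr ^ (2 * k + 1) * (s * σ)) : ℝ)
        + ((-1) ^ k * ((n.choose (2 * k + 1) : ℝ) * (s / r) ^ (n - 2 * k - 1) * pr ^ (2 * k + 1)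
            * (pφ * c)
          - (n.choose (2 * k) : ℝ) * (s / r) ^ (n - 2 * k) * pr ^ (2 * k) * (s * σ)) : ℝ)
          * Complex.I) := by
  rw [complexIntegral, add_I_mul_pow_eq_sum, Finset.sum_mul]
  refine Finset.sum_congr rfl fun k _ => ?_
  push_cast
  linear_combination (-(-1 : ℂ) ^ k * ((n.choose (2 * k + 1) : ℂ) * ((s : ℂ) / r) ^ (n - 2 * k - 1)
    * (pr : ℂ) ^ (2 * k + 1) * (s * σ))) * Complex.I_sq

lemma sum_eq_complexIntegral_re (n : ℕ) {g r : ℝ} (pr pφ c σ : ℝ) (hg : 0 < g) (hr : r ≠ 0) :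
    ∑ k ∈ Finset.range (n / 2 + 1), (-1 : ℝ) ^ k * (n.choose (2 * k) : ℝ)
        * Real.rpow g (((n : ℝ) - 2 * k) / 2) * (pr ^ (2 * k) / r ^ (n - 2 * k))
        * (pφ * c + ((n : ℝ) - 2 * k) / (2 * k + 1) * r * pr * σ)
      = (complexIntegral n √g r pr pφ c σ).re := by
  rw [complexIntegral_eq_sum, Complex.re_sum]
  refine Finset.sum_congr rfl fun k hk => ?_
  have hk : 2 * k ≤ n := by
    simp only [Finset.mem_range] at hk
    omega
  rw [rpow_half_eq_sqrt_pow hg.le hk]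
  have h1 := choose_mul_div_eq_choose_succ hk
  have h2 := choose_succ_mul_pow_div hk √g hr
  simp only [Complex.add_re, Complex.ofReal_re, Complex.re_ofReal_mul, Complex.I_re, mul_zero,
    add_zero]
  rw [div_pow √g r (n - 2 * k)]
  linear_combination
    ((-1) ^ k * √g ^ (n - 2 * k) * (pr ^ (2 * k) / r ^ (n - 2 * k)) * (r * pr * σ)) * h1
      - ((-1) ^ k * pr ^ (2 * k + 1) * σ) * h2

lemma sum_eq_neg_complexIntegral_im (n : ℕ) {g r : ℝ} (pr pφ c σ : ℝ) (hg : 0 < g) (hr : r ≠ 0) :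
    ∑ k ∈ Finset.range (n / 2 + 1), (-1 : ℝ) ^ k * (n.choose (2 * k) : ℝ)
        * Real.rpow g (((n : ℝ) - 2 * k - 1) / 2) * (pr ^ (2 * k) / r ^ (n - 2 * k))
        * (g * σ - ((n : ℝ) - 2 * k) / (2 * k + 1) * r * pr * pφ * c)
      = -(complexIntegral n √g r pr pφ c σ).im := by
  rw [complexIntegral_eq_sum, Complex.im_sum, ← Finset.sum_neg_distrib]
  refine Finset.sum_congr rfl fun k hk => ?_
  have hk : 2 * k ≤ n := by
    simp only [Finset.mem_range] at hk
    omega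
  have h0 := rpow_half_mul_sqrt_eq_sqrt_pow hg hk
  have h1 := choose_mul_div_eq_choose_succ hk
  have h2 := choose_succ_mul_pow_div hk √g hr
  have h3 := Real.mul_self_sqrt hg.le
  have hs : √g ≠ 0 := (Real.sqrt_pos.2 hg).ne'
  simp only [Complex.add_im, Complex.ofReal_im, Complex.im_ofReal_mul, Complex.I_im, mul_one,
    zero_add]
  apply mul_left_cancel₀ hs
  rw [div_pow √g r (n - 2 * k)]
  generalize Real.rpow g (((n : ℝ) - 2 * k - 1) / 2) = R at *
  linear_combination
    ((-1) ^ k * n.choose (2 * k) * (pr ^ (2 * k) / r ^ (n - 2 * k))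
        * (g * σ - ((n : ℝ) - 2 * k) / (2 * k + 1) * r * pr * pφ * c)) * h0
      - ((-1) ^ k * √g ^ (n - 2 * k) * (pr ^ (2 * k) / r ^ (n - 2 * k)) * (r * pr * pφ * c)) * h1
      + ((-1) ^ k * pr ^ (2 * k + 1) * pφ * c) * h2
      - ((-1) ^ k * n.choose (2 * k) * √g ^ (n - 2 * k) * (pr ^ (2 * k) / r ^ (n - 2 * k)) * σ) * h3

lemma HasDerivAt.complexIntegral (m : ℕ) {s r pr pφ c σ : ℝ → ℝ} {s' r' pr' pφ' c' σ' x : ℝ}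
    (hs : HasDerivAt s s' x) (hr : HasDerivAt r r' x) (hpr : HasDerivAt pr pr' x)
    (hpφ : HasDerivAt pφ pφ' x) (hc : HasDerivAt c c' x) (hσ : HasDerivAt σ σ' x)
    (hx : r x ≠ 0) :
    HasDerivAt (fun t => complexIntegral (m + 1) (s t) (r t) (pr t) (pφ t) (c t) (σ t))
      (((s x / r x : ℝ) + Complex.I * pr x) ^ m *
        ((m + 1) * (((s' * r x - s x * r') / r x ^ 2 : ℝ) + Complex.I * pr')
            * ((pφ x * c x : ℝ) - Complex.I * (s x * σ x : ℝ))
          + ((s x / r x : ℝ) + Complex.I * pr x)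
            * ((pφ' * c x + pφ x * c' : ℝ) - Complex.I * (s' * σ x + s x * σ' : ℝ)))) x := by
  have h := ((((hs.div hr hx).ofReal_comp.add
    (hpr.ofReal_comp.const_mul Complex.I))).pow (m + 1)).mul
    (((hpφ.mul hc).ofReal_comp).sub (((hs.mul hσ).ofReal_comp).const_mul Complex.I))
  refine h.congr_deriv ?_
  simp only [Pi.add_apply, Pi.sub_apply, Pi.mul_apply, Pi.div_apply, Pi.pow_apply, Nat.add_sub_cancel]
  push_cast
  ring

/-- If near a point `F` is the image of `Z` under a real-linear functional `L` and the bracket of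
`H` with `Z` vanishes there, so does the bracket of `H` with `F`. -/
lemma poissonBracket_eq_zero_of_complex {H F : ℝ → ℝ → ℝ → ℝ → ℝ} {Z : ℝ → ℝ → ℝ → ℝ → ℂ}
    {r φ pr pφ H₁ H₂ H₃ H₄ : ℝ} {Z₁ Z₂ Z₃ Z₄ : ℂ} (L : ℂ →L[ℝ] ℝ)
    (hH₁ : HasDerivAt (fun x => H x φ pr pφ) H₁ r) (hH₂ : HasDerivAt (fun x => H r x pr pφ) H₂ φ)
    (hH₃ : HasDerivAt (fun x => H r φ x pφ) H₃ pr) (hH₄ : HasDerivAt (fun x => H r φ pr x) H₄ pφ)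
    (hZ₁ : HasDerivAt (fun x => Z x φ pr pφ) Z₁ r) (hZ₂ : HasDerivAt (fun x => Z r x pr pφ) Z₂ φ)
    (hZ₃ : HasDerivAt (fun x => Z r φ x pφ) Z₃ pr) (hZ₄ : HasDerivAt (fun x => Z r φ pr x) Z₄ pφ)
    (hF₁ : ∀ᶠ x in nhds r, F x φ pr pφ = L (Z x φ pr pφ))
    (hF₂ : ∀ᶠ x in nhds φ, F r x pr pφ = L (Z r x pr pφ))
    (hF₃ : ∀ᶠ x in nhds pr, F r φ x pφ = L (Z r φ x pφ))
    (hF₄ : ∀ᶠ x in nhds pφ, F r φ pr x = L (Z r φ pr x))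
    (h : (H₁ : ℂ) * Z₃ - H₃ * Z₁ + H₂ * Z₄ - H₄ * Z₂ = 0) :
    poissonBracket H F r φ pr pφ = 0 := by
  have key := congrArg L h
  simp only [← Complex.real_smul, map_add, map_sub, map_smul, map_zero, smul_eq_mul] at key
  rw [poissonBracket, hH₁.deriv, hH₂.deriv, hH₃.deriv, hH₄.deriv,
    ((L.hasFDerivAt.comp_hasDerivAt r hZ₁).congr_of_eventuallyEq hF₁).deriv,
    ((L.hasFDerivAt.comp_hasDerivAt φ hZ₂).congr_of_eventuallyEq hF₂).deriv,
    ((L.hasFDerivAt.comp_hasDerivAt pr hZ₃).congr_of_eventuallyEq hF₃).deriv,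
    ((L.hasFDerivAt.comp_hasDerivAt pφ hZ₄).congr_of_eventuallyEq hF₄).deriv]
  exact key

/-- For the Hamiltonian `H = (1/2)(p_r² + p_φ²/r²) + a/(r² cos²(nφ))`
with `G = (1/2)p_φ² + a/cos²(nφ)`, the real and imaginary parts `F₁`, `F₂` of the
complex first integral are first integrals of `H` on the open set where `r > 0`,
`cos(nφ) ≠ 0`, `sin(nφ) ≠ 0` and `G > 0`. -/
theorem ttw_b_zero_additional_integrals (n : ℕ) (hn : 0 < n) (a : ℝ)
    (H G F₁ F₂ : ℝ → ℝ → ℝ → ℝ → ℝ)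
    (hH : H = fun r φ pr pφ =>
      (1 / 2) * (pr ^ 2 + pφ ^ 2 / r ^ 2) + a / (r ^ 2 * Real.cos (n * φ) ^ 2))
    (hG : G = fun _r φ _pr pφ => (1 / 2) * pφ ^ 2 + a / Real.cos (n * φ) ^ 2)
    (hF₁ : F₁ = fun r φ pr pφ =>
      ∑ k ∈ Finset.range (n / 2 + 1),
        (-1 : ℝ) ^ k * (n.choose (2 * k) : ℝ)
          * Real.rpow (2 * G r φ pr pφ) (((n : ℝ) - 2 * k) / 2)
          * (pr ^ (2 * k) / r ^ (n - 2 * k))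
          * (pφ * Real.cos (n * φ)
              + ((n : ℝ) - 2 * k) / (2 * k + 1) * r * pr * Real.sin (n * φ)))
    (hF₂ : F₂ = fun r φ pr pφ =>
      ∑ k ∈ Finset.range (n / 2 + 1),
        (-1 : ℝ) ^ k * (n.choose (2 * k) : ℝ)
          * Real.rpow (2 * G r φ pr pφ) (((n : ℝ) - 2 * k - 1) / 2)
          * (pr ^ (2 * k) / r ^ (n - 2 * k))
          * (2 * G r φ pr pφ * Real.sin (n * φ)
              - ((n : ℝ) - 2 * k) / (2 * k + 1) * r * pr * pφ * Real.cos (n * φ))) :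
    ∀ r φ pr pφ : ℝ, 0 < r → Real.cos (n * φ) ≠ 0 → Real.sin (n * φ) ≠ 0 →
      0 < G r φ pr pφ →
      poissonBracket H F₁ r φ pr pφ = 0 ∧ poissonBracket H F₂ r φ pr pφ = 0 := by
  intro r φ pr pφ hr hc _ hGpos
  obtain ⟨m, rfl⟩ : ∃ m, n = m + 1 := ⟨n - 1, by omega⟩
  generalize hN : ((m + 1 : ℕ) : ℝ) = N at *
  have hNm : (N : ℂ) = m + 1 := by rw [← hN]; push_cast; rfl
  have hr0 : r ≠ 0 := hr.ne'
  have hgpos : 0 < 2 * G r φ pr pφ := by linarith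
  have hcos : HasDerivAt (fun x => Real.cos (N * x)) (-(N * Real.sin (N * φ))) φ := by
    have h := ((hasDerivAt_id φ).const_mul N).cos
    exact h.congr_deriv (by simp only [id]; ring)
  have hsin : HasDerivAt (fun x => Real.sin (N * x)) (N * Real.cos (N * φ)) φ := by
    have h := ((hasDerivAt_id φ).const_mul N).sin
    exact h.congr_deriv (by simp only [id]; ring)
  have hHG : ∀ r φ pr pφ, H r φ pr pφ = (1 / 2) * pr ^ 2 + G r φ pr pφ * (r ^ 2)⁻¹ := by
    intro r φ pr pφ
    rw [hH, hG]
    simp only [div_eq_mul_inv, mul_inv]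
    ring
  have hG₂ : HasDerivAt (fun x => G r x pr pφ)
      (2 * a * N * Real.sin (N * φ) / Real.cos (N * φ) ^ 3) φ := by
    rw [hG]
    have h := ((hasDerivAt_const φ a).div (hcos.pow 2) (pow_ne_zero 2 hc)).const_add
      ((1 / 2) * pφ ^ 2)
    refine h.congr_deriv ?_
    simp only [Pi.pow_apply]
    field_simp
    ring
  have hG₄ : HasDerivAt (fun x => G r φ pr x) pφ pφ := by
    rw [hG]
    have h := (((hasDerivAt_id pφ).pow 2).const_mul (1 / 2 : ℝ)).add_const
      (a / Real.cos (N * φ) ^ 2)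
    refine h.congr_deriv ?_
    simp
  have hG₁ : ∀ x, G x φ pr pφ = G r φ pr pφ := fun x => by rw [hG]
  have hG₃ : ∀ x, G r φ x pφ = G r φ pr pφ := fun x => by rw [hG]
  have hGval : 2 * G r φ pr pφ * Real.cos (N * φ) ^ 2
      = pφ ^ 2 * Real.cos (N * φ) ^ 2 + 2 * a := by
    rw [hG]
    field_simp
  generalize hb : 2 * a * N * Real.sin (N * φ) / Real.cos (N * φ) ^ 3 = b at hG₂
  have hbc : b * Real.cos (N * φ)
      = N * Real.sin (N * φ) * (2 * G r φ pr pφ - pφ ^ 2) := by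
    rw [← hb, div_mul_eq_mul_div, div_eq_iff (pow_ne_zero 3 hc)]
    linear_combination (-(N * Real.sin (N * φ) * Real.cos (N * φ))) * hGval
  have hs₂ := (hG₂.const_mul 2).sqrt hgpos.ne'
  have hs₄ := (hG₄.const_mul 2).sqrt hgpos.ne'
  have hH₁ : HasDerivAt (fun x => H x φ pr pφ) (-(2 * G r φ pr pφ) / r ^ 3) r := by
    simp only [hHG, hG₁]
    have h := (((hasDerivAt_id r).pow 2).inv (pow_ne_zero 2 hr0)).const_mul (G r φ pr pφ)
      |>.const_add ((1 / 2) * pr ^ 2)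
    refine h.congr_deriv ?_
    simp only [Pi.pow_apply, id]
    field_simp
    ring
  have hH₂ : HasDerivAt (fun x => H r x pr pφ) (b * (r ^ 2)⁻¹) φ := by
    simp only [hHG]
    exact (hG₂.mul_const _).const_add _
  have hH₃ : HasDerivAt (fun x => H r φ x pφ) pr pr := by
    simp only [hHG, hG₃]
    have h := (((hasDerivAt_id pr).pow 2).const_mul (1 / 2 : ℝ)).add_const
      (G r φ pr pφ * (r ^ 2)⁻¹)
    refine h.congr_deriv ?_
    simp
  have hH₄ : HasDerivAt (fun x => H r φ pr x) (pφ * (r ^ 2)⁻¹) pφ := by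
    simp only [hHG]
    exact (hG₄.mul_const _).const_add _
  let Z : ℝ → ℝ → ℝ → ℝ → ℂ := fun r φ pr pφ => complexIntegral (m + 1) √(2 * G r φ pr pφ)
    r pr pφ (Real.cos (N * φ)) (Real.sin (N * φ))
  have hZ₁ := HasDerivAt.complexIntegral m (hasDerivAt_const r √(2 * G r φ pr pφ))
    (hasDerivAt_id r) (hasDerivAt_const r pr) (hasDerivAt_const r pφ)
    (hasDerivAt_const r (Real.cos (N * φ))) (hasDerivAt_const r (Real.sin (N * φ))) hr0
  have hZ₂ := HasDerivAt.complexIntegral m hs₂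
    (hasDerivAt_const φ r) (hasDerivAt_const φ pr) (hasDerivAt_const φ pφ) hcos hsin hr0
  have hZ₃ := HasDerivAt.complexIntegral m (hasDerivAt_const pr √(2 * G r φ pr pφ))
    (hasDerivAt_const pr r) (hasDerivAt_id pr) (hasDerivAt_const pr pφ)
    (hasDerivAt_const pr (Real.cos (N * φ))) (hasDerivAt_const pr (Real.sin (N * φ))) hr0
  have hZ₄ := HasDerivAt.complexIntegral m hs₄
    (hasDerivAt_const pφ r) (hasDerivAt_const pφ pr) (hasDerivAt_id pφ)
    (hasDerivAt_const pφ (Real.cos (N * φ))) (hasDerivAt_const pφ (Real.sin (N * φ))) hr0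
  have hZ₁' := hZ₁.congr_of_eventuallyEq (f₁ := fun x => Z x φ pr pφ)
    (.of_forall fun x => by simp only [Z, hG₁, id])
  have hZ₃' := hZ₃.congr_of_eventuallyEq (f₁ := fun x => Z r φ x pφ)
    (.of_forall fun x => by simp only [Z, hG₃, id])
  have bracket_eq_zero : ∀ (F : ℝ → ℝ → ℝ → ℝ → ℝ) (L : ℂ →L[ℝ] ℝ),
      (∀ r φ pr pφ, r ≠ 0 → 0 < G r φ pr pφ → F r φ pr pφ = L (Z r φ pr pφ)) →
      poissonBracket H F r φ pr pφ = 0 := by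
    intro F L hFL
    refine poissonBracket_eq_zero_of_complex L hH₁ hH₂ hH₃ hH₄ hZ₁' hZ₂ hZ₃' hZ₄ ?_ ?_ ?_ ?_ ?_
    · filter_upwards [eventually_ne_nhds hr0] with x hx
      exact hFL _ _ _ _ hx (by rw [hG₁]; exact hGpos)
    · filter_upwards [hG₂.continuousAt.eventually_const_lt hGpos] with x hx
      exact hFL _ _ _ _ hr0 hx
    · exact Filter.Eventually.of_forall fun x => hFL _ _ _ _ hr0 (by rw [hG₃]; exact hGpos)
    · filter_upwards [hG₄.continuousAt.eventually_const_lt hGpos] with x hx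
      exact hFL _ _ _ _ hr0 hx
    · have hsq : (√(2 * G r φ pr pφ) : ℂ) ^ 2 = ((2 * G r φ pr pφ : ℝ) : ℂ) := by
        rw [← Complex.ofReal_pow, Real.sq_sqrt hgpos.le]
      have hbc' := congrArg (Complex.ofReal) hbc
      generalize 2 * G r φ pr pφ = g at *
      generalize √g = s at *
      generalize Real.cos (N * φ) = c at *
      generalize Real.sin (N * φ) = σ at *
      simp only [id, ← hNm]
      push_cast at hbc' ⊢
      generalize ((s : ℂ) / r + Complex.I * pr) ^ m = W
      linear_combination
        (N * Complex.I * (pφ * c - Complex.I * (s * σ)) * W / r ^ 3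
            - W * (s / r + Complex.I * pr) * N * σ / r ^ 2) * hsq
          + W * (s / r + Complex.I * pr) / r ^ 2 * hbc'
          + W * N * s / r ^ 2 * ((pφ * c - Complex.I * (s * σ)) * pr
            + s * σ * (s / r + Complex.I * pr)) * Complex.I_sq
  constructor
  · refine bracket_eq_zero F₁ Complex.reCLM fun r φ pr pφ hr hg => ?_
    rw [hF₁, Complex.reCLM_apply]
    simp only [Z, ← hN]
    exact sum_eq_complexIntegral_re (m + 1) pr pφ _ _ (mul_pos two_pos hg) hr
  · refine bracket_eq_zero F₂ (-Complex.imCLM) fun r φ pr pφ hr hg => ?_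
    rw [hF₂, neg_apply, Complex.imCLM_apply]
    simp only [Z, ← hN]
    exact sum_eq_neg_complexIntegral_im (m + 1) pr pφ _ _ (mul_pos two_pos hg) hr
end

section
/- Let κ be a real number, n a positive integer, and a,b real parameters. Consider the curved Tremblay–Turbiner–Winternitz Hamiltonian H = (1/2)(p_r² + p_φ²/sk(r)²) + (a/cos²(nφ) + b/sin²(nφ))/sk(r)² and set G := (1/2)p_φ² + a/cos²(nφ) + b/sin²(nφ). Then on the open set where sk(r) ≠ 0, ck(r) ≠ 0, cos(nφ) ≠ 0, sin(nφ) ≠ 0 and G > 0, the functions I₁ := Σ_{j=0}^{n} (−1)ʲ C(2n,2j) (2G)^{n−j} (ck(r)/sk(r))^{2n−2j−1} p_r^{2j} [ G p_φ sin(2nφ) (ck(r)/sk(r)) − (2(n−j)/(2j+1)) p_r (G cos(2nφ) + b − a) ] and I₂ := Σ_{j=0}^{n} (−1)ʲ C(2n,2j) (2G)^{n−j} (ck(r)/sk(r))^{2n−2j−1} p_r^{2j} [ (ck(r)/sk(r)) (G cos(2nφ) + b − a) + ((n−j)/(2j+1)) p_r p_φ sin(2nφ) ] are first integrals of H: {H,I₁}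 = 0 and {H,I₂} = 0. -/
/-- The curvature-dependent cosine function `ck`. -/
noncomputable def ck (κ : ℝ) (x : ℝ) : ℝ :=
  if 0 < κ then Real.cos (Real.sqrt κ * x)
  else if κ = 0 then 1
  else Real.cosh (Real.sqrt (-κ) * x)

/-- The curvature-dependent sine function `sk`. -/
noncomputable def sk (κ : ℝ) (x : ℝ) : ℝ :=
  if 0 < κ then Real.sin (Real.sqrt κ * x) / Real.sqrt κ
  else if κ = 0 then x
  else Real.sinh (Real.sqrt (-κ) * x) / Real.sqrt (-κ)

theorem hasDerivAt_sk (κ x : ℝ) : HasDerivAt (sk κ) (ck κ x) x := by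
  rcases lt_trichotomy κ 0 with h | h | h
  · have h1 : Real.sqrt (-κ) ≠ 0 := (Real.sqrt_pos.2 (by linarith)).ne'
    have e : sk κ = fun x => Real.sinh (Real.sqrt (-κ) * x) / Real.sqrt (-κ) := by
      funext y; simp [sk, h.ne, h.not_gt]
    rw [e]
    have := (((hasDerivAt_id x).const_mul (Real.sqrt (-κ))).sinh).div_const (Real.sqrt (-κ))
    refine this.congr_deriv ?_
    simp [ck, h.ne, h.not_gt]
    field_simp
  · have e : sk κ = fun x => x := by funext y; simp [sk, h]
    rw [e]
    simpa [ck, h] using hasDerivAt_id' x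
  · have h1 : Real.sqrt κ ≠ 0 := (Real.sqrt_pos.2 h).ne'
    have e : sk κ = fun x => Real.sin (Real.sqrt κ * x) / Real.sqrt κ := by
      funext y; simp [sk, h]
    rw [e]
    have := (((hasDerivAt_id x).const_mul (Real.sqrt κ)).sin).div_const (Real.sqrt κ)
    refine this.congr_deriv ?_
    simp [ck, h]
    field_simp

theorem hasDerivAt_ck (κ x : ℝ) : HasDerivAt (ck κ) (-κ * sk κ x) x := by
  rcases lt_trichotomy κ 0 with h | h | h
  · have h1 : Real.sqrt (-κ) ≠ 0 := (Real.sqrt_pos.2 (by linarith)).ne'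
    have h2 : Real.sqrt (-κ) ^ 2 = -κ := Real.sq_sqrt (by linarith)
    have e : ck κ = fun x => Real.cosh (Real.sqrt (-κ) * x) := by
      funext y; simp [ck, h.ne, h.not_gt]
    rw [e]
    refine (((hasDerivAt_id x).const_mul (Real.sqrt (-κ))).cosh).congr_deriv ?_
    simp only [sk, h.ne, h.not_gt, if_false, id]
    field_simp
    linear_combination Real.sinh (Real.sqrt (-κ) * x) * h2
  · have e : ck κ = fun _ => 1 := by funext y; simp [ck, h]
    rw [e]
    simpa [h] using hasDerivAt_const x (1 : ℝ)
  · have h1 : Real.sqrt κ ≠ 0 := (Real.sqrt_pos.2 h).ne'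
    have h2 : Real.sqrt κ ^ 2 = κ := Real.sq_sqrt h.le
    have e : ck κ = fun x => Real.cos (Real.sqrt κ * x) := by
      funext y; simp [ck, h]
    rw [e]
    refine (((hasDerivAt_id x).const_mul (Real.sqrt κ)).cos).congr_deriv ?_
    simp only [sk, h, if_true, id]
    field_simp
    linear_combination -Real.sin (Real.sqrt κ * x) * h2

theorem ck_sq_add_mul_sk_sq (κ x : ℝ) : ck κ x ^ 2 + κ * sk κ x ^ 2 = 1 := by
  rcases lt_trichotomy κ 0 with h | h | h
  · have h1 : Real.sqrt (-κ) ≠ 0 := (Real.sqrt_pos.2 (by linarith)).ne'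
    have h2 : Real.sqrt (-κ) ^ 2 = -κ := Real.sq_sqrt (by linarith)
    simp only [sk, ck, h.ne, h.not_gt, if_false, div_pow, h2, Real.cosh_sq]
    field_simp [h.ne]
    ring
  · simp [ck, h]
  · have h2 : Real.sqrt κ ^ 2 = κ := Real.sq_sqrt h.le
    simp only [sk, ck, h, if_true, div_pow, h2, Real.cos_sq']
    field_simp [h.ne']
    ring

theorem hasDerivAt_ck_div_sk (κ x : ℝ) (hx : sk κ x ≠ 0) :
    HasDerivAt (fun y => ck κ y / sk κ y) (-(1 / sk κ x ^ 2)) x := by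
  refine ((hasDerivAt_ck κ x).div (hasDerivAt_sk κ x) hx).congr_deriv ?_
  field_simp
  linear_combination -ck_sq_add_mul_sk_sq κ x

/-- The real part of `(√(2 * g) * t + i * p) ^ (2 * n)`, a polynomial in `g`, `t`, `p`. -/
noncomputable def rePart (n : ℕ) (g t p : ℝ) : ℝ :=
  ∑ j ∈ Finset.range (n + 1), (-1 : ℝ) ^ j * ((2 * n).choose (2 * j) : ℝ)
    * (2 * g) ^ (n - j) * t ^ (2 * n - 2 * j) * p ^ (2 * j)

/-- `√(2 * g)` times the imaginary part of `(√(2 * g) * t + i * p) ^ (2 * n)`,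
a polynomial in `g`, `t`, `p`. -/
noncomputable def imPart (n : ℕ) (g t p : ℝ) : ℝ :=
  ∑ j ∈ Finset.range n, (-1 : ℝ) ^ j * ((2 * n).choose (2 * j + 1) : ℝ)
    * (2 * g) ^ (n - j) * t ^ (2 * n - (2 * j + 1)) * p ^ (2 * j + 1)

theorem differentiable_rePart_fst (n : ℕ) (t p : ℝ) :
    Differentiable ℝ (fun g => rePart n g t p) := by
  unfold rePart; fun_prop

theorem differentiable_imPart_fst (n : ℕ) (t p : ℝ) :
    Differentiable ℝ (fun g => imPart n g t p) := by
  unfold imPart; fun_prop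

theorem hasDerivAt_rePart_snd (n : ℕ) (g t p : ℝ) :
    HasDerivAt (fun x => rePart n g x p)
      (∑ j ∈ Finset.range (n + 1), (-1 : ℝ) ^ j * ((2 * n).choose (2 * j) : ℝ)
        * (2 * g) ^ (n - j) * (((2 * n - 2 * j : ℕ) : ℝ) * t ^ (2 * n - 2 * j - 1))
        * p ^ (2 * j)) t := by
  unfold rePart
  exact HasDerivAt.fun_sum fun j _ => ((hasDerivAt_pow _ t).const_mul _).mul_const _

theorem hasDerivAt_rePart_thd (n : ℕ) (g t p : ℝ) :
    HasDerivAt (fun x => rePart n g t x)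
      (∑ j ∈ Finset.range (n + 1), (-1 : ℝ) ^ j * ((2 * n).choose (2 * j) : ℝ)
        * (2 * g) ^ (n - j) * t ^ (2 * n - 2 * j)
        * (((2 * j : ℕ) : ℝ) * p ^ (2 * j - 1))) p := by
  unfold rePart
  exact HasDerivAt.fun_sum fun j _ => (hasDerivAt_pow _ p).const_mul _

theorem hasDerivAt_imPart_snd (n : ℕ) (g t p : ℝ) :
    HasDerivAt (fun x => imPart n g x p)
      (∑ j ∈ Finset.range n, (-1 : ℝ) ^ j * ((2 * n).choose (2 * j + 1) : ℝ)
        * (2 * g) ^ (n - j)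
        * (((2 * n - (2 * j + 1) : ℕ) : ℝ) * t ^ (2 * n - (2 * j + 1) - 1))
        * p ^ (2 * j + 1)) t := by
  unfold imPart
  exact HasDerivAt.fun_sum fun j _ => ((hasDerivAt_pow _ t).const_mul _).mul_const _

theorem hasDerivAt_imPart_thd (n : ℕ) (g t p : ℝ) :
    HasDerivAt (fun x => imPart n g t x)
      (∑ j ∈ Finset.range n, (-1 : ℝ) ^ j * ((2 * n).choose (2 * j + 1) : ℝ)
        * (2 * g) ^ (n - j) * t ^ (2 * n - (2 * j + 1))
        * (((2 * j + 1 : ℕ) : ℝ) * p ^ (2 * j))) p := by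
  unfold imPart
  exact HasDerivAt.fun_sum fun j _ => (hasDerivAt_pow _ p).const_mul _

theorem choose_succ_mul_cast (m k : ℕ) (h : k ≤ m) :
    (m.choose (k + 1) : ℝ) * (k + 1) = m.choose k * (m - k) := by
  have := Nat.choose_succ_right_eq m k
  rw [← Nat.cast_sub h]
  exact_mod_cast this

theorem rePart_rotation (n : ℕ) (g t p : ℝ) :
    p * deriv (fun x => rePart n g x p) t - 2 * g * t * deriv (fun x => rePart n g t x) p
      = 2 * n * imPart n g t p := by
  rw [(hasDerivAt_rePart_snd n g t p).deriv, (hasDerivAt_rePart_thd n g t p).deriv,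
    Finset.sum_range_succ, Finset.sum_range_succ' (n := n)]
  simp only [Nat.sub_self, Nat.cast_zero, zero_mul, mul_zero, add_zero]
  rw [imPart, Finset.mul_sum, Finset.mul_sum, Finset.mul_sum, ← Finset.sum_sub_distrib]
  refine Finset.sum_congr rfl fun j hj => ?_
  obtain ⟨k, rfl⟩ := Nat.exists_eq_add_of_lt (Finset.mem_range.1 hj)
  have h1 := choose_succ_mul_cast (2 * (j + k + 1)) (2 * j) (by omega)
  have h2 := choose_succ_mul_cast (2 * (j + k + 1)) (2 * j + 1) (by omega)
  rw [show j + k + 1 - j = k + 1 by omega, show j + k + 1 - (j + 1) = k by omega,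
    show 2 * (j + k + 1) - 2 * j = 2 * k + 2 by omega,
    show 2 * (j + k + 1) - 2 * (j + 1) = 2 * k by omega,
    show 2 * (j + k + 1) - (2 * j + 1) = 2 * k + 1 by omega,
    show 2 * k + 2 - 1 = 2 * k + 1 by omega,
    show 2 * (j + 1) - 1 = 2 * j + 1 by omega]
  rw [show 2 * (j + 1) = 2 * j + 1 + 1 by omega]
  push_cast at h1 h2 ⊢
  linear_combination (-1 : ℝ) ^ j * (2 * g) ^ (k + 1) * t ^ (2 * k + 1) * p ^ (2 * j + 1)
    * (h2 - h1)

theorem imPart_rotation (n : ℕ) (g t p : ℝ) :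
    p * deriv (fun x => imPart n g x p) t - 2 * g * t * deriv (fun x => imPart n g t x) p
      = -(4 * n * g * rePart n g t p) := by
  have e : -(4 * n * g * rePart n g t p) =
      (∑ j ∈ Finset.range (n + 1), -2 * g * (2 * j) * ((-1 : ℝ) ^ j
        * ((2 * n).choose (2 * j) : ℝ) * (2 * g) ^ (n - j) * t ^ (2 * n - 2 * j) * p ^ (2 * j)))
      + ∑ j ∈ Finset.range (n + 1), -2 * g * (2 * n - 2 * j) * ((-1 : ℝ) ^ j
        * ((2 * n).choose (2 * j) : ℝ) * (2 * g) ^ (n - j) * t ^ (2 * n - 2 * j)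
        * p ^ (2 * j)) := by
    rw [rePart, Finset.mul_sum, ← Finset.sum_neg_distrib, ← Finset.sum_add_distrib]
    exact Finset.sum_congr rfl fun j _ => by ring
  rw [e, (hasDerivAt_imPart_snd n g t p).deriv, (hasDerivAt_imPart_thd n g t p).deriv,
    Finset.sum_range_succ', Finset.sum_range_succ (n := n)]
  simp only [sub_self, Nat.cast_zero, zero_mul, mul_zero, add_zero]
  rw [Finset.mul_sum, Finset.mul_sum, ← Finset.sum_sub_distrib, ← Finset.sum_add_distrib]
  refine Finset.sum_congr rfl fun j hj => ?_
  obtain ⟨k, rfl⟩ := Nat.exists_eq_add_of_lt (Finset.mem_range.1 hj)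
  have h1 := choose_succ_mul_cast (2 * (j + k + 1)) (2 * j) (by omega)
  have h2 := choose_succ_mul_cast (2 * (j + k + 1)) (2 * j + 1) (by omega)
  rw [show j + k + 1 - j = k + 1 by omega, show j + k + 1 - (j + 1) = k by omega,
    show 2 * (j + k + 1) - 2 * j = 2 * k + 2 by omega,
    show 2 * (j + k + 1) - 2 * (j + 1) = 2 * k by omega,
    show 2 * (j + k + 1) - (2 * j + 1) = 2 * k + 1 by omega,
    show 2 * k + 1 - 1 = 2 * k by omega]
  rw [show 2 * (j + 1) = 2 * j + 1 + 1 by omega]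
  push_cast at h1 h2 ⊢
  linear_combination -(-1 : ℝ) ^ j * (2 * g) ^ (k + 1) * (t ^ (2 * k) * p ^ (2 * j + 2) * h2
    + t ^ (2 * k + 2) * p ^ (2 * j) * 2 * g * h1)

/-- If `α`, `β` rotate under the bracket with the angular energy `g`, then
`α · rePart + β · imPart` Poisson-commutes with `p_r² / 2 + g / sk²`. -/
theorem poissonBracket_eq_zero_of_rotation (κ : ℝ) (n : ℕ) (g α β : ℝ → ℝ → ℝ)
    (H F : ℝ → ℝ → ℝ → ℝ → ℝ)
    (hH : H = fun r φ pr pφ => pr ^ 2 / 2 + g φ pφ / sk κ r ^ 2)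
    (hF : ∀ r φ pr pφ, sk κ r ≠ 0 → ck κ r ≠ 0 →
      F r φ pr pφ = α φ pφ * rePart n (g φ pφ) (ck κ r / sk κ r) pr
        + β φ pφ * imPart n (g φ pφ) (ck κ r / sk κ r) pr)
    (r φ pr pφ gφ αφ αp βφ βp : ℝ) (hs : sk κ r ≠ 0) (hc : ck κ r ≠ 0)
    (hgφ : HasDerivAt (fun x => g x pφ) gφ φ) (hgp : HasDerivAt (fun x => g φ x) pφ pφ)
    (hαφ : HasDerivAt (fun x => α x pφ) αφ φ) (hαp : HasDerivAt (fun x => α φ x) αp pφ)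
    (hβφ : HasDerivAt (fun x => β x pφ) βφ φ) (hβp : HasDerivAt (fun x => β φ x) βp pφ)
    (hα : gφ * αp - pφ * αφ = 4 * n * g φ pφ * β φ pφ)
    (hβ : gφ * βp - pφ * βφ = -(2 * n * α φ pφ)) :
    poissonBracket H F r φ pr pφ = 0 := by
  have hT := hasDerivAt_ck_div_sk κ r hs
  have hHr : deriv (fun x => H x φ pr pφ) r
      = -2 * g φ pφ * (ck κ r / sk κ r) * (1 / sk κ r ^ 2) := by
    rw [hH]
    refine (((((hasDerivAt_sk κ r).pow 2).fun_inv (pow_ne_zero 2 hs)).const_mul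
      (g φ pφ)).const_add (pr ^ 2 / 2)).deriv.trans ?_
    simp
    field_simp
  have hHpr : deriv (fun x => H r φ x pφ) pr = pr := by
    rw [hH]
    refine (((hasDerivAt_pow 2 pr).div_const 2).add_const _).deriv.trans ?_
    simp
  have hHφ : deriv (fun x => H r x pr pφ) φ = gφ * (1 / sk κ r ^ 2) := by
    rw [hH]
    refine ((hgφ.div_const _).const_add _).deriv.trans ?_
    ring
  have hHp : deriv (fun x => H r φ pr x) pφ = pφ * (1 / sk κ r ^ 2) := by
    rw [hH]
    refine ((hgp.div_const _).const_add _).deriv.trans ?_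
    ring
  have hXg := (differentiable_rePart_fst n (ck κ r / sk κ r) pr (g φ pφ)).hasDerivAt
  have hYg := (differentiable_imPart_fst n (ck κ r / sk κ r) pr (g φ pφ)).hasDerivAt
  have hXt := (hasDerivAt_rePart_snd n (g φ pφ) (ck κ r / sk κ r) pr).differentiableAt.hasDerivAt
  have hYt := (hasDerivAt_imPart_snd n (g φ pφ) (ck κ r / sk κ r) pr).differentiableAt.hasDerivAt
  have hXp := (hasDerivAt_rePart_thd n (g φ pφ) (ck κ r / sk κ r) pr).differentiableAt.hasDerivAt
  have hYp := (hasDerivAt_imPart_thd n (g φ pφ) (ck κ r / sk κ r) pr).differentiableAt.hasDerivAt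
  have hX := rePart_rotation n (g φ pφ) (ck κ r / sk κ r) pr
  have hY := imPart_rotation n (g φ pφ) (ck κ r / sk κ r) pr
  have hFr := (((hXt.comp r hT).const_mul (α φ pφ)).add
    ((hYt.comp r hT).const_mul (β φ pφ))).congr_of_eventuallyEq (f₁ := fun x => F x φ pr pφ) <| by
      filter_upwards [(hasDerivAt_sk κ r).continuousAt.eventually_ne hs,
        (hasDerivAt_ck κ r).continuousAt.eventually_ne hc] with x h1 h2
      exact hF x φ pr pφ h1 h2
  have hFpr := ((hXp.const_mul (α φ pφ)).add (hYp.const_mul (β φ pφ))).congr_of_eventuallyEq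
    (f₁ := fun x => F r φ x pφ) (.of_forall fun x => hF r φ x pφ hs hc)
  have hXgφ : HasDerivAt (fun x => rePart n (g x pφ) (ck κ r / sk κ r) pr) _ φ :=
    hXg.comp (h := fun x => g x pφ) φ hgφ
  have hXgp : HasDerivAt (fun x => rePart n (g φ x) (ck κ r / sk κ r) pr) _ pφ :=
    hXg.comp (h := fun x => g φ x) pφ hgp
  have hYgφ : HasDerivAt (fun x => imPart n (g x pφ) (ck κ r / sk κ r) pr) _ φ :=
    hYg.comp (h := fun x => g x pφ) φ hgφ
  have hYgp : HasDerivAt (fun x => imPart n (g φ x) (ck κ r / sk κ r) pr) _ pφ :=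
    hYg.comp (h := fun x => g φ x) pφ hgp
  have hFφ := ((hαφ.mul hXgφ).add (hβφ.mul hYgφ)).congr_of_eventuallyEq
    (f₁ := fun x => F r x pr pφ) (.of_forall fun x => hF r x pr pφ hs hc)
  have hFp := ((hαp.mul hXgp).add (hβp.mul hYgp)).congr_of_eventuallyEq
    (f₁ := fun x => F r φ pr x) (.of_forall fun x => hF r φ pr x hs hc)
  rw [poissonBracket, hHr, hHpr, hHφ, hHp, hFr.deriv, hFpr.deriv, hFφ.deriv, hFp.deriv]
  linear_combination (1 / sk κ r ^ 2) * (α φ pφ * hX + β φ pφ * hY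
    + rePart n (g φ pφ) (ck κ r / sk κ r) pr * hα
    + imPart n (g φ pφ) (ck κ r / sk κ r) pr * hβ)

/-- The sums defining the integrals, split into their `rePart` and `imPart` components. -/
theorem sum_eq_rePart_add_imPart (n : ℕ) (g t p A B : ℝ) (ht : t ≠ 0) :
    ∑ j ∈ Finset.range (n + 1), (-1 : ℝ) ^ j * ((2 * n).choose (2 * j) : ℝ)
        * (2 * g) ^ (n - j) * t ^ (2 * (n : ℤ) - 2 * j - 1) * p ^ (2 * j)
        * (A * t + 2 * ((n : ℝ) - j) / (2 * j + 1) * p * B)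
      = A * rePart n g t p + B * imPart n g t p := by
  have hY : imPart n g t p = ∑ j ∈ Finset.range (n + 1),
      (-1 : ℝ) ^ j * ((2 * n).choose (2 * j + 1) : ℝ)
        * (2 * g) ^ (n - j) * t ^ (2 * (n : ℤ) - 2 * j - 1) * p ^ (2 * j + 1) := by
    rw [Finset.sum_range_succ, Nat.choose_succ_self, imPart]
    simp only [Nat.cast_zero, mul_zero, zero_mul, add_zero]
    refine Finset.sum_congr rfl fun j hj => ?_
    have := Finset.mem_range.1 hj
    rw [← zpow_natCast t, Nat.cast_sub (by omega)]
    push_cast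
    rw [sub_sub]
  rw [hY, rePart, Finset.mul_sum, Finset.mul_sum, ← Finset.sum_add_distrib]
  refine Finset.sum_congr rfl fun j hj => ?_
  have hj := Finset.mem_range.1 hj
  have h1 : t ^ (2 * n - 2 * j) = t ^ (2 * (n : ℤ) - 2 * j - 1) * t := by
    rw [← zpow_add_one₀ ht, ← zpow_natCast t, Nat.cast_sub (by omega)]
    push_cast
    rw [sub_add_cancel]
  have h2 := choose_succ_mul_cast (2 * n) (2 * j) (by omega)
  have h3 : (2 * j + 1 : ℝ) ≠ 0 := by positivity
  have h4 : ((2 * n).choose (2 * j + 1) : ℝ)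
      = (2 * n).choose (2 * j) * (2 * ((n : ℝ) - j) / (2 * j + 1)) := by
    push_cast at h2
    field_simp
    linear_combination h2
  rw [h1, h4]
  ring

/-- For the curved TTW Hamiltonian
`H = (1/2)(p_r² + p_φ²/sk(r)²) + (a/cos²(nφ) + b/sin²(nφ))/sk(r)²` with
`G = (1/2)p_φ² + a/cos²(nφ) + b/sin²(nφ)`, the functions `I₁`, `I₂` below are first
integrals of `H` on the open set where `sk(r) ≠ 0`, `ck(r) ≠ 0`, `cos(nφ) ≠ 0`,
`sin(nφ) ≠ 0` and `G > 0`. -/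
theorem curved_ttw_additional_integrals (κ : ℝ) (n : ℕ) (hn : 0 < n) (a b : ℝ)
    (H G I₁ I₂ : ℝ → ℝ → ℝ → ℝ → ℝ)
    (hH : H = fun r φ pr pφ =>
      (1 / 2) * (pr ^ 2 + pφ ^ 2 / (sk κ r) ^ 2)
        + (a / Real.cos (n * φ) ^ 2 + b / Real.sin (n * φ) ^ 2) / (sk κ r) ^ 2)
    (hG : G = fun _r φ _pr pφ =>
      (1 / 2) * pφ ^ 2 + a / Real.cos (n * φ) ^ 2 + b / Real.sin (n * φ) ^ 2)
    (hI₁ : I₁ = fun r φ pr pφ =>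
      ∑ j ∈ Finset.range (n + 1),
        (-1 : ℝ) ^ j * ((2 * n).choose (2 * j) : ℝ)
          * (2 * G r φ pr pφ) ^ (n - j)
          * (ck κ r / sk κ r) ^ (2 * (n : ℤ) - 2 * j - 1)
          * pr ^ (2 * j)
          * (G r φ pr pφ * pφ * Real.sin (2 * n * φ) * (ck κ r / sk κ r)
              - 2 * ((n : ℝ) - j) / (2 * j + 1) * pr
                * (G r φ pr pφ * Real.cos (2 * n * φ) + b - a)))
    (hI₂ : I₂ = fun r φ pr pφ =>
      ∑ j ∈ Finset.range (n + 1),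
        (-1 : ℝ) ^ j * ((2 * n).choose (2 * j) : ℝ)
          * (2 * G r φ pr pφ) ^ (n - j)
          * (ck κ r / sk κ r) ^ (2 * (n : ℤ) - 2 * j - 1)
          * pr ^ (2 * j)
          * ((ck κ r / sk κ r) * (G r φ pr pφ * Real.cos (2 * n * φ) + b - a)
              + ((n : ℝ) - j) / (2 * j + 1) * pr * pφ * Real.sin (2 * n * φ))) :
    ∀ r φ pr pφ : ℝ, sk κ r ≠ 0 → ck κ r ≠ 0 → Real.cos (n * φ) ≠ 0 →
      Real.sin (n * φ) ≠ 0 → 0 < G r φ pr pφ →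
      poissonBracket H I₁ r φ pr pφ = 0 ∧ poissonBracket H I₂ r φ pr pφ = 0 := by
  intro r φ pr pφ hs hc hcos hsin _
  have hφ : HasDerivAt (fun x : ℝ => n * x) n φ := by
    simpa using (hasDerivAt_id φ).const_mul (n : ℝ)
  have hφ₂ : HasDerivAt (fun x : ℝ => 2 * n * x) (2 * n) φ := by
    simpa using (hasDerivAt_id φ).const_mul (2 * n : ℝ)
  have hsin₂ : Real.sin (2 * n * φ) = 2 * Real.sin (n * φ) * Real.cos (n * φ) := by
    rw [mul_assoc, Real.sin_two_mul]
  have hcos₂ : Real.cos (2 * n * φ) = Real.cos (n * φ) ^ 2 - Real.sin (n * φ) ^ 2 := by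
    rw [mul_assoc, Real.cos_two_mul']
  set g : ℝ → ℝ → ℝ := fun φ pφ =>
    (1 / 2) * pφ ^ 2 + a / Real.cos (n * φ) ^ 2 + b / Real.sin (n * φ) ^ 2 with hg
  set P : ℝ → ℝ → ℝ := fun φ pφ => pφ * Real.sin (2 * n * φ) with hP
  set B : ℝ → ℝ → ℝ := fun φ pφ => g φ pφ * Real.cos (2 * n * φ) + b - a with hB
  obtain ⟨gφ, hgφ_def⟩ : ∃ c : ℝ, c = 2 * n * a * Real.sin (n * φ) / Real.cos (n * φ) ^ 3
    - 2 * n * b * Real.cos (n * φ) / Real.sin (n * φ) ^ 3 := ⟨_, rfl⟩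
  have hgφ : HasDerivAt (fun x => g x pφ) gφ φ := by
    have h1 := ((hφ.cos.pow 2).fun_inv (pow_ne_zero 2 hcos)).const_mul a
    have h2 := ((hφ.sin.pow 2).fun_inv (pow_ne_zero 2 hsin)).const_mul b
    refine ((h1.const_add ((1 / 2) * pφ ^ 2)).add h2).congr_deriv ?_
    rw [hgφ_def]
    simp
    field_simp
    ring
  have hgp : HasDerivAt (fun x => g φ x) pφ pφ := by
    refine ((((hasDerivAt_pow 2 pφ).const_mul (1 / 2)).add_const _).add_const _).congr_deriv ?_
    simp
  have hPφ : HasDerivAt (fun x => P x pφ) (pφ * (Real.cos (2 * n * φ) * (2 * n))) φ :=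
    hφ₂.sin.const_mul pφ
  have hPp : HasDerivAt (fun x => P φ x) (Real.sin (2 * n * φ)) pφ := by
    simpa using (hasDerivAt_id pφ).mul_const (Real.sin (2 * n * φ))
  have hBφ := ((hgφ.mul hφ₂.cos).add_const b).sub_const a
  have hBp := ((hgp.mul_const (Real.cos (2 * n * φ))).add_const b).sub_const a
  have hDP : gφ * Real.sin (2 * n * φ) - pφ * (pφ * (Real.cos (2 * n * φ) * (2 * n)))
      = -(4 * n * B φ pφ) := by
    have key : gφ * Real.sin (2 * n * φ) = -(4 * n * ((a / Real.cos (n * φ) ^ 2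
        + b / Real.sin (n * φ) ^ 2) * Real.cos (2 * n * φ) + b - a)) := by
      rw [hgφ_def, hsin₂, hcos₂]
      field_simp
      ring
    simp only [hB, hg]
    linear_combination key
  have hH' : H = fun r φ pr pφ => pr ^ 2 / 2 + g φ pφ / sk κ r ^ 2 := by
    rw [hH]
    funext r φ pr pφ
    simp only [hg]
    ring
  constructor
  · refine poissonBracket_eq_zero_of_rotation κ n g (fun x y => g x y * P x y)
      (fun x y => -B x y) H I₁ hH' ?_ r φ pr pφ gφ _ _ _ _ hs hc hgφ hgp (hgφ.mul hPφ)
      (hgp.mul hPp) hBφ.neg hBp.neg ?_ ?_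
    · intro r φ pr pφ hs hc
      rw [← sum_eq_rePart_add_imPart n _ _ _ _ _ (div_ne_zero hc hs), hI₁, hG]
      refine Finset.sum_congr rfl fun j _ => ?_
      simp only [hB, hP, hg]
      ring
    · linear_combination g φ pφ * hDP
    · simp only [hP]
      ring
  · refine poissonBracket_eq_zero_of_rotation κ n g B
      (fun x y => P x y / 2) H I₂ hH' ?_ r φ pr pφ gφ _ _ _ _ hs hc hgφ hgp hBφ hBp
      (hPφ.div_const 2) (hPp.div_const 2) ?_ ?_
    · intro r φ pr pφ hs hc
      rw [← sum_eq_rePart_add_imPart n _ _ _ _ _ (div_ne_zero hc hs), hI₂, hG]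
      refine Finset.sum_congr rfl fun j _ => ?_
      simp only [hB, hP, hg]
      ring
    · simp only [hP]
      ring
    · linear_combination hDP / 2
end
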